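/- arXiv:1612.03031 — 2 statements merged into one kernel-verified Lean document; each statement's English description precedes it below -/
import Mathlib

section
/- Let r ∈ ℝ, σ > 0, τ > 0 and x > 0. Then there exists C′ > 0 (depending on r, σ, τ, x) such that for all Δy ∈ (0,1], the midpoint-rule total mass of the Black–Scholes state price density satisfies | Σ_{j≥1} G_τ(x, y_j) Δy − e^{−rτ} | ≤ C′ (Δy)², the series converging absolutely. -/
open MeasureTheory Set

/-- Black–Scholes state price density over horizon `τ`. -/
noncomputable def bsG (r σ τ x y : ℝ) : ℝ :=
  (1 / y) * (Real.exp (-r * τ) / Real.sqrt (2 * Real.pi * σ ^ 2 * τ)) *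
    Real.exp (-(Real.log y - Real.log x - (r - σ ^ 2 / 2) * τ) ^ 2 / (2 * σ ^ 2 * τ))

/-- Midpoint grid on `(0,∞)`: for `j : ℕ`, `gridPt Δy j = (j + 1/2) Δy`, i.e. the point
`(j' − 1/2)Δy` for the `j'`-th grid point, `j' = j + 1 ≥ 1`. -/
noncomputable def gridPt (Δy : ℝ) (j : ℕ) : ℝ := ((j : ℝ) + 1 / 2) * Δy

lemma cell_bound (f f' f'' : ℝ → ℝ)
    (h1 : ∀ y, 0 < y → HasDerivAt f (f' y) y) (h2 : ∀ y, 0 < y → HasDerivAt f' (f'' y) y)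
    (hf : IntegrableOn f (Ioi 0)) (hf2 : IntegrableOn f'' (Ioi 0))
    (l h : ℝ) (hl : 0 ≤ l) (hh : 0 < h) :
    |f (l + h / 2) * h - ∫ y in Ioc l (l + h), f y| ≤ h ^ 2 * ∫ y in Ioc l (l + h), |f'' y| := by
  set V := ∫ y in Ioc l (l + h), |f'' y| with hV
  set m := l + h / 2 with hm
  have hsub : Ioc l (l + h) ⊆ Ioi 0 := fun y hy => lt_of_le_of_lt hl hy.1
  have hmm : m ∈ Ioc l (l + h) := ⟨by rw [hm]; linarith, by rw [hm]; linarith⟩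
  have hV0 : 0 ≤ V := integral_nonneg fun _ => abs_nonneg _
  have key1 : ∀ s ∈ Ioc l (l + h), |f' s - f' m| ≤ V := by
    intro s hs
    have hs' : uIcc m s ⊆ Ioc l (l + h) := ordConnected_Ioc.uIcc_subset hmm hs
    have hs'' : uIoc m s ⊆ Ioc l (l + h) := uIoc_subset_uIcc.trans hs'
    rw [← intervalIntegral.integral_eq_sub_of_hasDerivAt (f := f') (f' := f'')
      (fun y hy => h2 y (hsub (hs' hy)))
      ((hf2.mono_set (hs'.trans hsub)).intervalIntegrable)]
    refine (intervalIntegral.norm_integral_le_integral_norm_uIoc (f := f'') (μ := volume)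
      (a := m) (b := s)).trans ?_
    refine setIntegral_mono_set (hf2.mono_set hsub).norm ?_ hs''.eventuallyLE
    exact Filter.Eventually.of_forall fun _ => norm_nonneg _
  have key2 : ∀ t ∈ Ioc l (l + h), |f t - f m - f' m * (t - m)| ≤ V * h := by
    intro t ht
    have := (convex_Ioc l (l + h)).norm_image_sub_le_of_norm_hasDerivWithin_le
      (f := fun t => f t - f' m * (t - m)) (f' := fun t => f' t - f' m) (C := V)
      (fun s hs => by
        have := (h1 s (hsub hs)).sub (((hasDerivAt_id s).sub_const m).const_mul (f' m))
        rw [mul_one] at this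
        exact this.hasDerivWithinAt) key1 hmm ht
    simp only [sub_self, mul_zero, sub_zero, Real.norm_eq_abs] at this
    have e : f t - f m - f' m * (t - m) = f t - f' m * (t - m) - f m := by ring
    rw [e]
    refine this.trans (mul_le_mul_of_nonneg_left ?_ hV0)
    rw [abs_le]; constructor <;> rw [hm] <;> linarith [ht.1, ht.2]
  have hle : l ≤ l + h := by linarith
  have hi : IntegrableOn f (Ioc l (l + h)) := hf.mono_set hsub
  have hii : IntervalIntegrable f volume l (l + h) := (intervalIntegrable_iff_integrableOn_Ioc_of_le hle).2 hi
  have hlin : ∫ t in l..(l + h), (f m + f' m * (t - m)) = f m * h := by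
    rw [intervalIntegral.integral_add (by simp) (Continuous.intervalIntegrable (by fun_prop) _ _),
      intervalIntegral.integral_const_mul, intervalIntegral.integral_sub (by simp) (by simp)]
    simp [hm]
    ring_nf
  rw [← hlin, ← intervalIntegral.integral_of_le hle,
    ← intervalIntegral.integral_sub (Continuous.intervalIntegrable (by fun_prop) _ _) hii]
  have := intervalIntegral.norm_integral_le_of_norm_le_const (a := l) (b := l + h) (C := V * h)
    (f := fun t => f m + f' m * (t - m) - f t) (by
      intro t ht
      rw [uIoc_of_le hle] at ht
      have := key2 t ht
      rw [← abs_neg] at this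
      rw [Real.norm_eq_abs]
      convert this using 2
      ring)
  rw [Real.norm_eq_abs] at this
  refine this.trans (le_of_eq ?_)
  rw [add_sub_cancel_left, abs_of_pos hh]; ring

lemma midpoint_sum (f f' f'' : ℝ → ℝ)
    (h1 : ∀ y, 0 < y → HasDerivAt f (f' y) y) (h2 : ∀ y, 0 < y → HasDerivAt f' (f'' y) y)
    (hf : IntegrableOn f (Ioi 0)) (hf2 : IntegrableOn f'' (Ioi 0)) (h : ℝ) (hh : 0 < h) :
    Summable (fun j : ℕ => f (gridPt h j) * h) ∧
      |(∑' j : ℕ, f (gridPt h j) * h) - ∫ y in Ioi 0, f y| ≤ (∫ y in Ioi 0, |f'' y|) * h ^ 2 := by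
  let s : ℕ → Set ℝ := fun j => Ioc ((j : ℝ) * h) ((j : ℝ) * h + h)
  have hs : ∀ j, MeasurableSet (s j) := fun j => measurableSet_Ioc
  have hdis : Pairwise (Function.onFun Disjoint s) := by
    intro i j hij
    refine Set.disjoint_left.2 fun y hi hj => hij ?_
    have a1 : (i : ℝ) < j + 1 := by
      have := hi.1.trans_le hj.2
      by_contra hc; push Not at hc; nlinarith
    have a2 : (j : ℝ) < i + 1 := by
      have := hj.1.trans_le hi.2
      by_contra hc; push Not at hc; nlinarith
    have a3 : i < j + 1 := by exact_mod_cast a1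
    have a4 : j < i + 1 := by exact_mod_cast a2
    omega
  have hU : (⋃ j, s j) = Ioi 0 := by
    ext y
    simp only [mem_iUnion, mem_Ioi, s, mem_Ioc]
    constructor
    · rintro ⟨j, hj, -⟩
      exact lt_of_le_of_lt (by positivity) hj
    · intro hy
      have hp : 0 < y / h := by positivity
      have hc : 0 < ⌈y / h⌉₊ := Nat.ceil_pos.2 hp
      obtain ⟨k, hk⟩ := Nat.exists_eq_succ_of_ne_zero hc.ne'
      have b1 := Nat.le_ceil (y / h)
      have b2 := Nat.ceil_lt_add_one hp.le
      rw [hk] at b1 b2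
      push_cast at b1 b2
      rw [div_le_iff₀ hh] at b1
      have b3 : (k : ℝ) < y / h := by linarith
      rw [lt_div_iff₀ hh] at b3
      exact ⟨k, b3, by linarith⟩
  have S1 : HasSum (fun j => ∫ y in s j, f y) (∫ y in Ioi 0, f y) := by
    have := hasSum_integral_iUnion (f := f) (μ := volume) hs hdis (by rwa [hU])
    rwa [hU] at this
  have S2 : HasSum (fun j => ∫ y in s j, |f'' y|) (∫ y in Ioi 0, |f'' y|) := by
    have := hasSum_integral_iUnion (f := fun y => |f'' y|) (μ := volume) hs hdis
      (by rw [hU]; exact hf2.norm)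
    rwa [hU] at this
  have hb : ∀ j : ℕ, ‖f (gridPt h j) * h - ∫ y in s j, f y‖ ≤ h ^ 2 * ∫ y in s j, |f'' y| := by
    intro j
    have e : gridPt h j = (j : ℝ) * h + h / 2 := by unfold gridPt; ring
    rw [e]
    exact cell_bound f f' f'' h1 h2 hf hf2 _ h (by positivity) hh
  have S3 := S2.mul_left (h ^ 2)
  have S4 : Summable (fun j : ℕ => f (gridPt h j) * h - ∫ y in s j, f y) :=
    S3.summable.of_norm_bounded hb
  have S5 : Summable (fun j : ℕ => f (gridPt h j) * h) := by
    simpa using S4.add S1.summable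
  refine ⟨S5, ?_⟩
  rw [← S1.tsum_eq, ← S5.tsum_sub S1.summable, mul_comm]
  exact tsum_of_norm_bounded S3 hb

lemma cov_integrable (g : ℝ → ℝ) :
    IntegrableOn g (Ioi 0) ↔ Integrable (fun u => Real.exp u * g (Real.exp u)) := by
  have := integrableOn_image_iff_integrableOn_abs_deriv_smul (s := univ) (f := Real.exp)
    (f' := Real.exp) MeasurableSet.univ (fun x _ => (Real.hasDerivAt_exp x).hasDerivWithinAt)
    Real.exp_injective.injOn g
  simpa [Real.range_exp] using this

lemma cov_integral (g : ℝ → ℝ) :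
    ∫ y in Ioi 0, g y = ∫ u, Real.exp u * g (Real.exp u) := by
  have := integral_image_eq_integral_abs_deriv_smul (s := univ) (f := Real.exp)
    (f' := Real.exp) MeasurableSet.univ (fun x _ => (Real.hasDerivAt_exp x).hasDerivWithinAt)
    Real.exp_injective.injOn g
  simpa [Real.range_exp] using this

lemma gauss_poly (a b p q w : ℝ) (hb : 0 < b) :
    Integrable (fun u : ℝ => Real.exp (-2 * u) * (p + q * (u - a) + w * (u - a) ^ 2) *
      Real.exp (-b * (u - a) ^ 2)) := by
  have : Integrable (fun v : ℝ => Real.exp (-2 * (v + a)) * (p + q * v + w * v ^ 2) *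
      Real.exp (-b * v ^ 2)) := by
    have hg := (integrable_exp_neg_mul_sq (b := b / 2) (by positivity)).const_mul
      (Real.exp (-2 * a + 4 / b) * ((|p| + |q| + |w|) * (1 + 4 / b)))
    refine hg.mono' (Continuous.aestronglyMeasurable (by fun_prop)) (Filter.Eventually.of_forall ?_)
    intro v
    have e1 : |p + q * v + w * v ^ 2| ≤ (|p| + |q| + |w|) * (1 + v ^ 2) := by
      have t1 : |p + q * v + w * v ^ 2| ≤ |p| + |q| * |v| + |w| * v ^ 2 := by
        refine (abs_add_le _ _).trans (add_le_add ((abs_add_le _ _).trans ?_) ?_)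
        · rw [abs_mul]
        · rw [abs_mul, abs_of_nonneg (sq_nonneg v)]
      have t2 : |v| ≤ 1 + v ^ 2 := by
        have := sq_abs v
        nlinarith [sq_nonneg (|v| - 1), abs_nonneg v]
      have t3 := mul_le_mul_of_nonneg_left t2 (abs_nonneg q)
      nlinarith [abs_nonneg p, abs_nonneg w, mul_nonneg (abs_nonneg p) (sq_nonneg v)]
    have e2 : 1 + v ^ 2 ≤ (1 + 4 / b) * Real.exp (b * v ^ 2 / 4) := by
      have t := Real.add_one_le_exp (b * v ^ 2 / 4)
      have t' : 1 ≤ Real.exp (b * v ^ 2 / 4) := Real.one_le_exp (by positivity)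
      have : v ^ 2 = 4 / b * (b * v ^ 2 / 4) := by field_simp
      have hb4 : 0 < 4 / b := by positivity
      nlinarith [mul_le_mul_of_nonneg_left t hb4.le]
    have e3 : -2 * (v + a) ≤ -2 * a + 4 / b + b * v ^ 2 / 4 := by
      have : 4 / b + b * v ^ 2 / 4 + 2 * v = (b * v / 2 + 2) ^ 2 / b := by field_simp; ring
      have : 0 ≤ (b * v / 2 + 2) ^ 2 / b := by positivity
      linarith
    have e4 := Real.exp_le_exp.2 e3
    rw [Real.norm_eq_abs, abs_mul, abs_mul, Real.abs_exp, Real.abs_exp]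
    calc Real.exp (-2 * (v + a)) * |p + q * v + w * v ^ 2| * Real.exp (-b * v ^ 2)
        ≤ Real.exp (-2 * a + 4 / b + b * v ^ 2 / 4) *
          ((|p| + |q| + |w|) * ((1 + 4 / b) * Real.exp (b * v ^ 2 / 4))) *
            Real.exp (-b * v ^ 2) := by
          gcongr
          exact e1.trans (mul_le_mul_of_nonneg_left e2 (by positivity))
      _ = Real.exp (-2 * a + 4 / b) * ((|p| + |q| + |w|) * (1 + 4 / b)) *
          (Real.exp (b * v ^ 2 / 4) * Real.exp (b * v ^ 2 / 4) * Real.exp (-b * v ^ 2)) := by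
          rw [Real.exp_add]; ring
      _ = _ := by
          rw [← Real.exp_add, ← Real.exp_add]
          congr 2; ring
  have h2 := this.comp_sub_right a
  simpa using h2

theorem bsG_midpoint_mass (r σ τ x : ℝ) (hσ : 0 < σ) (hτ : 0 < τ) (hx : 0 < x) :
    ∃ C' > (0 : ℝ), ∀ Δy ∈ Ioc (0 : ℝ) 1,
      Summable (fun j : ℕ => bsG r σ τ x (gridPt Δy j) * Δy) ∧
      |(∑' j : ℕ, bsG r σ τ x (gridPt Δy j) * Δy) - Real.exp (-r * τ)| ≤ C' * Δy ^ 2 := by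
  obtain ⟨b, hbdef⟩ : ∃ b, b = 1 / (2 * σ ^ 2 * τ) := ⟨_, rfl⟩
  obtain ⟨a, ha⟩ : ∃ a, a = Real.log x + (r - σ ^ 2 / 2) * τ := ⟨_, rfl⟩
  obtain ⟨c, hc⟩ : ∃ c, c = Real.exp (-r * τ) / Real.sqrt (2 * Real.pi * σ ^ 2 * τ) := ⟨_, rfl⟩
  have hb : 0 < b := by rw [hbdef]; positivity
  have hG : bsG r σ τ x = fun y => c * (y⁻¹ * Real.exp (-b * (Real.log y - a) ^ 2)) := by
    funext y
    unfold bsG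
    rw [← hc]
    have : -(Real.log y - Real.log x - (r - σ ^ 2 / 2) * τ) ^ 2 / (2 * σ ^ 2 * τ)
        = -b * (Real.log y - a) ^ 2 := by rw [hbdef, ha]; ring
    rw [this]; ring
  have hE : ∀ y : ℝ, 0 < y → HasDerivAt (fun y => Real.exp (-b * (Real.log y - a) ^ 2))
      (Real.exp (-b * (Real.log y - a) ^ 2) * (-b * (2 * (Real.log y - a) * y⁻¹))) y := by
    intro y hy
    have := (((((Real.hasDerivAt_log hy.ne').sub_const a).pow 2).const_mul (-b))).exp
    simpa using this
  have d1 : ∀ y : ℝ, 0 < y → HasDerivAt (bsG r σ τ x)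
      (c * ((y⁻¹) ^ 2 * (-1 - 2 * b * (Real.log y - a)) *
        Real.exp (-b * (Real.log y - a) ^ 2))) y := by
    intro y hy
    rw [hG]
    refine HasDerivAt.congr_deriv (((hasDerivAt_inv hy.ne').mul (hE y hy)).const_mul c) ?_
    field_simp
    ring
  have d2 : ∀ y : ℝ, 0 < y → HasDerivAt (fun y => c * ((y⁻¹) ^ 2 * (-1 - 2 * b * (Real.log y - a)) *
        Real.exp (-b * (Real.log y - a) ^ 2)))
      (c * ((y⁻¹) ^ 3 * ((2 - 2 * b) + 6 * b * (Real.log y - a) + 4 * b ^ 2 * (Real.log y - a) ^ 2) *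
        Real.exp (-b * (Real.log y - a) ^ 2))) y := by
    intro y hy
    refine HasDerivAt.congr_deriv (((((hasDerivAt_inv hy.ne').pow 2).mul
      ((((Real.hasDerivAt_log hy.ne').sub_const a).const_mul (2 * b)).const_sub (-1))).mul
        (hE y hy)).const_mul c) ?_
    simp
    field_simp
    ring_nf
    simp
  have hcov : (fun u => Real.exp u * bsG r σ τ x (Real.exp u))
      = fun u => c * Real.exp (-b * (u - a) ^ 2) := by
    funext u
    rw [hG]
    simp only [Real.log_exp]
    have := (Real.exp_pos u).ne'
    field_simp
  have i1 : IntegrableOn (bsG r σ τ x) (Ioi 0) := by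
    rw [cov_integrable, hcov]
    exact ((integrable_exp_neg_mul_sq hb).comp_sub_right a).const_mul c
  have I1 : ∫ y in Ioi 0, bsG r σ τ x y = Real.exp (-r * τ) := by
    rw [cov_integral, hcov, integral_const_mul,
      integral_sub_right_eq_self (fun u => Real.exp (-b * u ^ 2)) a, integral_gaussian, hc]
    have : Real.pi / b = 2 * Real.pi * σ ^ 2 * τ := by rw [hbdef]; field_simp
    rw [this]
    have : Real.sqrt (2 * Real.pi * σ ^ 2 * τ) ≠ 0 := by positivity
    field_simp
  have i2 : IntegrableOn (fun y => c * ((y⁻¹) ^ 3 * ((2 - 2 * b) + 6 * b * (Real.log y - a) + 4 * b ^ 2 * (Real.log y - a) ^ 2) *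
        Real.exp (-b * (Real.log y - a) ^ 2))) (Ioi 0) := by
    rw [cov_integrable]
    convert (gauss_poly a b (2 - 2 * b) (6 * b) (4 * b ^ 2) hb).const_mul c using 2 with u
    rw [Real.log_exp]
    have e : Real.exp (-2 * u) = Real.exp u * (Real.exp u)⁻¹ ^ 3 := by
      rw [← Real.exp_neg, ← Real.exp_nat_mul, ← Real.exp_add]
      congr 1; push_cast; ring
    rw [e]; ring
  refine ⟨(∫ y in Ioi 0, |c * ((y⁻¹) ^ 3 * ((2 - 2 * b) + 6 * b * (Real.log y - a) + 4 * b ^ 2 * (Real.log y - a) ^ 2) *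
        Real.exp (-b * (Real.log y - a) ^ 2))|) + 1,
    add_pos_of_nonneg_of_pos (integral_nonneg fun _ => abs_nonneg _) one_pos, ?_⟩
  intro h hh
  obtain ⟨A, B⟩ := midpoint_sum _ _ _ d1 d2 i1 i2 h hh.1
  refine ⟨A, ?_⟩
  rw [I1] at B
  refine B.trans ?_
  gcongr
  linarith
end

section
/- Let L ∈ ℕ, let I and J be countable index sets with I = J, for each l ∈ {1,…,L−1} let g^{(l)} : I × I → [0,∞) satisfy Σ_{j∈I} g^{(l)}_{ij} ≤ 1 for every i ∈ I, and let h^{(l)} : I → ℝ be bounded. Let a^{(L)} = b^{(L)} : I → ℝ be bounded, define the exact backward recursion a^{(l)}_i = max{ h^{(l)}_i, Σ_{j∈I} g^{(l)}_{ij} a^{(l+1)}_j } for l = L−1,…,1, and suppose b^{(l)} : I → ℝ are bounded functions satisfying, for some η ≥ 0 and all i ∈ I and l ∈ {1,…,L−1}, | b^{(l)}_i − max{ h^{(l)}_i, Σ_{j∈I} g^{(l)}_{ij} b^{(l+1)}_j } | ≤ η (all series converging absolutely). Then for every l ∈ {1,…,L}, sup_{i∈I} | a^{(l)}_i − b^{(l)}_i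 | ≤ (L − l) η; i.e., per-step quadrature errors accumulate at most additively through the sub-stochastic max-recursion. -/
/-- Stability of the backward dynamic-programming max-recursion with sub-stochastic
nonnegative weights: if the exact recursion `a` and an approximate recursion `b` agree at the
terminal date `L − 1` (0-indexed dates `0, …, L − 1`), and each backward step of `b` is
computed with error at most `η`, then `sup_i |a l i − b l i| ≤ (L − 1 − l) η` for every date
`l`; i.e. per-step quadrature errors accumulate at most additively. -/
theorem backward_recursion_stability
    {I : Type*} [Countable I] (L : ℕ) (hL : 1 ≤ L)
    (g : ℕ → I → I → ℝ) (h : ℕ → I → ℝ) (a b : ℕ → I → ℝ) (η : ℝ) (hη : 0 ≤ η)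
    (hg_nonneg : ∀ l, l + 1 < L → ∀ i j : I, 0 ≤ g l i j)
    (hg_row : ∀ l, l + 1 < L → ∀ i : I, Summable (g l i) ∧ (∑' j : I, g l i j) ≤ 1)
    (hh_bdd : ∀ l, l + 1 < L → ∃ B : ℝ, ∀ i : I, |h l i| ≤ B)
    (ha_bdd : ∀ l < L, ∃ B : ℝ, ∀ i : I, |a l i| ≤ B)
    (hb_bdd : ∀ l < L, ∃ B : ℝ, ∀ i : I, |b l i| ≤ B)
    (hterm : ∀ i : I, a (L - 1) i = b (L - 1) i)
    (ha_rec : ∀ l, l + 1 < L → ∀ i : I,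
      Summable (fun j : I => g l i j * a (l + 1) j) ∧
      a l i = max (h l i) (∑' j : I, g l i j * a (l + 1) j))
    (hb_rec : ∀ l, l + 1 < L → ∀ i : I,
      Summable (fun j : I => g l i j * b (l + 1) j) ∧
      |b l i - max (h l i) (∑' j : I, g l i j * b (l + 1) j)| ≤ η) :
    ∀ l < L, ∀ i : I, |a l i - b l i| ≤ ((L - 1 - l : ℕ) : ℝ) * η := by
  have key : ∀ n l : ℕ, l + n + 1 = L → ∀ i : I, |a l i - b l i| ≤ (n : ℝ) * η := by
    intro n
    induction n with
    | zero =>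
      intro l hl i
      have e : l = L - 1 := by omega
      rw [e, hterm i]
      simp
    | succ n ih =>
      intro l hl i
      have hl' : l + 1 < L := by omega
      have ih' := ih (l + 1) (by omega)
      obtain ⟨sa, ea⟩ := ha_rec l hl' i
      obtain ⟨sb, eb⟩ := hb_rec l hl' i
      obtain ⟨sg, hg1⟩ := hg_row l hl' i
      have hC : 0 ≤ (n : ℝ) * η := by positivity
      have sC : Summable (fun j : I => g l i j * ((n : ℝ) * η)) := sg.mul_right _
      have tC : ∑' j : I, g l i j * ((n : ℝ) * η) ≤ (n : ℝ) * η := by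
        rw [tsum_mul_right]
        nlinarith
      have h1 : ∑' j : I, g l i j * a (l + 1) j
          ≤ ∑' j : I, g l i j * b (l + 1) j + ∑' j : I, g l i j * ((n : ℝ) * η) := by
        rw [← sb.tsum_add sC]
        refine sa.tsum_le_tsum (fun j => ?_) (sb.add sC)
        have := (abs_le.mp (ih' j)).2
        nlinarith [hg_nonneg l hl' i j]
      have h2 : ∑' j : I, g l i j * b (l + 1) j
          ≤ ∑' j : I, g l i j * a (l + 1) j + ∑' j : I, g l i j * ((n : ℝ) * η) := by
        rw [← sa.tsum_add sC]
        refine sb.tsum_le_tsum (fun j => ?_) (sa.add sC)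
        have := (abs_le.mp (ih' j)).1
        nlinarith [hg_nonneg l hl' i j]
      have h3 := abs_max_sub_max_le_abs (∑' j : I, g l i j * a (l + 1) j)
        (∑' j : I, g l i j * b (l + 1) j) (h l i)
      rw [max_comm _ (h l i), max_comm _ (h l i), ← ea] at h3
      have h4 : |∑' j : I, g l i j * a (l + 1) j - ∑' j : I, g l i j * b (l + 1) j|
          ≤ (n : ℝ) * η := abs_le.mpr ⟨by linarith, by linarith⟩
      have h5 := abs_le.mp (h3.trans h4)
      have h6 := abs_le.mp eb
      push_cast
      exact abs_le.mpr ⟨by linarith [h5.1, h6.2], by linarith [h5.2, h6.1]⟩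
  intro l hl i
  exact key (L - 1 - l) l (by omega) i
end
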